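/- Let k ≥ 1 and let F be an intersecting k-Sperner family of subsets of [n]. Then |F| ≤ Σ_I(n,k). -/

import Mathlib

/-- `Σ_I(n,k)` from the paper. -/
def SigmaI (n k : ℕ) : ℕ :=
  if n % 2 = 1 then
    ∑ i ∈ Finset.Icc ((n + 1) / 2) ((n + 1) / 2 + k - 1), Nat.choose n i
  else
    Nat.choose (n - 1) (n / 2 - 1) +
      ∑ i ∈ Finset.Icc (n / 2 + 1) (n / 2 + k - 1), Nat.choose n i +
      Nat.choose (n - 1) (n / 2 + k)

/-- A family of finite sets is intersecting if any two members meet. -/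
def Intersecting {α : Type*} [DecidableEq α] (F : Finset (Finset α)) : Prop :=
  ∀ A ∈ F, ∀ B ∈ F, (A ∩ B).Nonempty

/-- A family is butterfly-free if there are no four distinct members
`A,B,C,D` with `A ⊆ C`, `A ⊆ D`, `B ⊆ C`, `B ⊆ D`. -/
def ButterflyFree {α : Type*} (F : Finset (Finset α)) : Prop :=
  ¬ ∃ A B C D : Finset α, A ∈ F ∧ B ∈ F ∧ C ∈ F ∧ D ∈ F ∧
    A ≠ B ∧ A ≠ C ∧ A ≠ D ∧ B ≠ C ∧ B ≠ D ∧ C ≠ D ∧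
    A ⊆ C ∧ A ⊆ D ∧ B ⊆ C ∧ B ⊆ D

/-- A family is `k`-Sperner if it contains no chain of `k+1` distinct sets. -/
def KSperner {α : Type*} (k : ℕ) (F : Finset (Finset α)) : Prop :=
  ¬ ∃ c : Fin (k + 1) → Finset α, (∀ i, c i ∈ F) ∧ StrictMono c

section IntersectingSperner

open Finset

theorem sum_mul_add_le_of_antitone {w x : ℕ → ℕ} (M K N S : ℕ) (hw : Antitone w)
    (hx : ∀ i < M, x i ≤ N) (hS : ∑ i ∈ range M, x i ≤ S) :
    ∑ i ∈ range M, x i * w i + N * K * w K ≤ N * ∑ i ∈ range K, w i + S * w K := by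
  have key : ∑ i ∈ range M, (x i : ℤ) * ((w i : ℤ) - w K) ≤
      ∑ i ∈ range K, (N : ℤ) * ((w i : ℤ) - w K) := by
    calc ∑ i ∈ range M, (x i : ℤ) * ((w i : ℤ) - w K)
        ≤ ∑ i ∈ range M, if i < K then (N : ℤ) * ((w i : ℤ) - w K) else 0 := by
          refine sum_le_sum fun i hi => ?_
          have hxi : (x i : ℤ) ≤ N := by exact_mod_cast hx i (mem_range.1 hi)
          split_ifs with h
          · have : (w K : ℤ) ≤ w i := by exact_mod_cast hw h.le
            gcongr
          · have : (w i : ℤ) ≤ w K := by exact_mod_cast hw (not_lt.1 h)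
            exact mul_nonpos_of_nonneg_of_nonpos (by positivity) (by linarith)
      _ = ∑ i ∈ range M with i < K, (N : ℤ) * ((w i : ℤ) - w K) := by rw [sum_filter]
      _ ≤ _ := by
          refine sum_le_sum_of_subset_of_nonneg (fun i hi => ?_) fun i hi _ => ?_
          · exact mem_range.2 (mem_filter.1 hi).2
          · have : (w K : ℤ) ≤ w i := by exact_mod_cast hw (mem_range.1 hi).le
            exact mul_nonneg (by positivity) (by linarith)
  simp only [mul_sub, sum_sub_distrib, ← sum_mul, ← mul_sum, sum_const, card_range,
    nsmul_eq_mul] at key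
  have h2 : (∑ i ∈ range M, (x i : ℤ)) * w K ≤ S * w K := by
    gcongr
    exact_mod_cast hS
  zify
  linarith

theorem choose_add_antitone {n r : ℕ} (h : n ≤ 2 * r + 1) :
    Antitone fun i => n.choose (r + i) := by
  refine antitone_nat_of_succ_le fun i => ?_
  have h1 := Nat.choose_succ_right_eq n (r + i)
  have h2 : n - (r + i) ≤ r + i + 1 := by omega
  have h3 : n.choose (r + i + 1) * (r + i + 1) ≤ n.choose (r + i) * (r + i + 1) := by
    rw [h1]; gcongr
  exact Nat.le_of_mul_le_mul_right h3 (by omega)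

theorem sum_range_add_middle (f : ℕ → ℕ) (m : ℕ) :
    ∑ i ∈ range (2 * m + 1), f i + f m = ∑ i ∈ range (m + 1), (f (m + i) + f (m - i)) := by
  have h1 := sum_range_reflect f (m + 1)
  simp only [Nat.add_sub_cancel] at h1
  rw [sum_add_distrib, h1, two_mul, add_assoc, sum_range_add, sum_range_succ f m]
  ring

theorem sum_range_two_mul_add_two (f : ℕ → ℕ) (m : ℕ) :
    ∑ i ∈ range (2 * m + 2), f i = ∑ i ∈ range (m + 1), (f (m + 1 + i) + f (m - i)) := by
  have h1 := sum_range_reflect f (m + 1)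
  simp only [Nat.add_sub_cancel] at h1
  rw [sum_add_distrib, h1, show 2 * m + 2 = (m + 1) + (m + 1) by ring, sum_range_add, add_comm]

theorem sum_mul_choose_le_of_even (m k S : ℕ) (u : ℕ → ℕ)
    (hu : ∀ l ≤ 2 * m, u l + u (2 * m - l) ≤ 2 * m) (hS : ∑ l ∈ range (2 * m + 1), u l ≤ S) :
    ∑ l ∈ range (2 * m + 1), u l * (2 * m).choose l + m * (2 * m).choose m
        + 2 * m * k * (2 * m).choose (m + k) ≤
      2 * m * ∑ i ∈ range k, (2 * m).choose (m + i) + (S + m) * (2 * m).choose (m + k) := by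
  set x : ℕ → ℕ := fun i => if i = 0 then u m + m else u (m + i) + u (m - i)
  have hx : ∀ i < m + 1, x i ≤ 2 * m := by
    intro i hi
    simp only [x]
    split_ifs with h
    · have := hu m (by omega)
      rw [show 2 * m - m = m by omega] at this
      omega
    · have := hu (m + i) (by omega)
      rwa [show 2 * m - (m + i) = m - i by omega] at this
  have hsum : ∀ w : ℕ → ℕ, (∀ i ≤ m, w (m - i) = w (m + i)) →
      ∑ i ∈ range (m + 1), x i * w (m + i) = ∑ l ∈ range (2 * m + 1), u l * w l + m * w m := by
    intro w hw
    have h1 := sum_range_add_middle (fun l => u l * w l) m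
    rw [sum_range_succ' _ m] at h1 ⊢
    have h2 : ∑ i ∈ range m, x (i + 1) * w (m + (i + 1)) =
        ∑ i ∈ range m, (u (m + (i + 1)) * w (m + (i + 1)) + u (m - (i + 1)) * w (m - (i + 1))) := by
      refine sum_congr rfl fun i hi => ?_
      rw [hw (i + 1) (by have := mem_range.1 hi; omega), ← add_mul]
      simp [x]
    rw [h2]
    simp only [x, if_true, add_zero, tsub_zero] at h1 ⊢
    linarith
  have hsym : ∀ i ≤ m, (2 * m).choose (m - i) = (2 * m).choose (m + i) := by
    intro i hi
    rw [← Nat.choose_symm (show m + i ≤ 2 * m by omega)]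
    congr 1
    omega
  have hS' : ∑ i ∈ range (m + 1), x i ≤ S + m := by
    have := hsum (fun _ => 1) (fun _ _ => rfl)
    simp only [mul_one] at this
    omega
  have := sum_mul_add_le_of_antitone (m + 1) k (2 * m) (S + m)
    (choose_add_antitone (n := 2 * m) (r := m) (by omega)) hx hS'
  rw [hsum _ hsym] at this
  exact this

theorem sum_mul_choose_le_of_odd (m k S : ℕ) (u : ℕ → ℕ)
    (hu : ∀ l ≤ 2 * m + 1, u l + u (2 * m + 1 - l) ≤ 2 * m + 1)
    (hS : ∑ l ∈ range (2 * m + 2), u l ≤ S) :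
    ∑ l ∈ range (2 * m + 2), u l * (2 * m + 1).choose l
        + (2 * m + 1) * k * (2 * m + 1).choose (m + 1 + k) ≤
      (2 * m + 1) * ∑ i ∈ range k, (2 * m + 1).choose (m + 1 + i)
        + S * (2 * m + 1).choose (m + 1 + k) := by
  have hsym : ∀ i ≤ m, (2 * m + 1).choose (m - i) = (2 * m + 1).choose (m + 1 + i) := by
    intro i hi
    rw [← Nat.choose_symm (show m + 1 + i ≤ 2 * m + 1 by omega)]
    congr 1
    omega
  have h1 : ∑ l ∈ range (2 * m + 2), u l * (2 * m + 1).choose l =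
      ∑ i ∈ range (m + 1), (u (m + 1 + i) + u (m - i)) * (2 * m + 1).choose (m + 1 + i) := by
    rw [sum_range_two_mul_add_two]
    refine sum_congr rfl fun i hi => ?_
    rw [hsym i (by have := mem_range.1 hi; omega), add_mul]
  rw [sum_range_two_mul_add_two] at hS
  rw [h1]
  refine sum_mul_add_le_of_antitone (m + 1) k (2 * m + 1) S
    (choose_add_antitone (n := 2 * m + 1) (r := m + 1) (by omega)) (fun i hi => ?_) hS
  have := hu (m + 1 + i) (by omega)
  rwa [show 2 * m + 1 - (m + 1 + i) = m - i by omega] at this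

theorem exists_strictMonoOn_of_kSperner {α : Type*} {k : ℕ} {F : Finset (Finset α)}
    (hS : KSperner k F) :
    ∃ h : Finset α → ℕ, (∀ A ∈ F, h A < k) ∧ ∀ A ∈ F, ∀ B ∈ F, A ⊂ B → h A < h B := by
  classical
  have hlt : ∀ x : F, Order.height x < k := by
    intro x
    by_contra hx
    obtain ⟨p, -, hp⟩ := Order.exists_series_of_le_height x (not_lt.1 hx)
    subst hp
    exact hS ⟨fun i => (p i : Finset α), fun i => (p i).2, fun i j hij => p.strictMono hij⟩
  have hne : ∀ x : F, Order.height x ≠ ⊤ := fun x => ((hlt x).trans_le le_top).ne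
  refine ⟨fun A => if hA : A ∈ F then (Order.height (⟨A, hA⟩ : F)).toNat else 0, ?_, ?_⟩
  · intro A hA
    simp only [dif_pos hA]
    have := hlt ⟨A, hA⟩
    rw [← ENat.natCast_toNat (hne ⟨A, hA⟩)] at this
    exact_mod_cast this
  · intro A hA B hB hAB
    simp only [dif_pos hA, dif_pos hB]
    have : Order.height (⟨A, hA⟩ : F) < Order.height (⟨B, hB⟩ : F) :=
      Order.height_strictMono hAB ((hlt _).trans_le le_top)
    rw [← ENat.natCast_toNat (hne ⟨A, hA⟩), ← ENat.natCast_toNat (hne ⟨B, hB⟩)] at this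
    exact_mod_cast this

theorem not_ssubset_of_height_eq {α : Type*} {F : Finset (Finset α)} {h : Finset α → ℕ}
    (hh : ∀ A ∈ F, ∀ B ∈ F, A ⊂ B → h A < h B)
    (i : ℕ) :
    ∀ A ∈ ({A ∈ F | h A = i} : Finset _), ∀ B ∈ ({A ∈ F | h A = i} : Finset _), ¬ A ⊂ B := by
  intro A hA B hB hAB
  rw [mem_filter] at hA hB
  have := hh A hA.1 B hB.1 hAB
  omega

/-- `c` lists a set of size `n` in a cyclic order: it has period `n` and is injective on each window
of length `n`. -/
structure IsCyclicNumbering {α : Type*} (n : ℕ) (c : ℕ → α) : Prop where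
  periodic : ∀ i, c (i + n) = c i
  ne : ∀ i j, i < j → j < i + n → c i ≠ c j

/-- The arc of `l` consecutive elements of the cyclic order `c`, beginning with `c s`. -/
def arc {α : Type*} [DecidableEq α] (c : ℕ → α) (s l : ℕ) : Finset α :=
  (Ico s (s + l)).image c

/-- The number of starting points of the arcs of length `l` that belong to `F`. -/
def arcCount {α : Type*} [DecidableEq α] (n : ℕ) (c : ℕ → α) (F : Finset (Finset α)) (l : ℕ) : ℕ :=
  #{s ∈ range n | arc c s l ∈ F}

/-- The pairs (start, length) whose arc belongs to `F`. -/
def arcFamily {α : Type*} [DecidableEq α] (n : ℕ) (c : ℕ → α) (F : Finset (Finset α)) :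
    Finset (ℕ × ℕ) :=
  {p ∈ range n ×ˢ range (n + 1) | arc c p.1 p.2 ∈ F}

section Arc

variable {α : Type*} [DecidableEq α] {n : ℕ} {c : ℕ → α} {F : Finset (Finset α)}

theorem mem_arcFamily {p : ℕ × ℕ} :
    p ∈ arcFamily n c F ↔ p.1 < n ∧ p.2 ≤ n ∧ arc c p.1 p.2 ∈ F := by
  simp [arcFamily, and_assoc]

theorem card_arcFamily : #(arcFamily n c F) = ∑ l ∈ range (n + 1), arcCount n c F l := by
  simp only [arcFamily, arcCount, card_filter, sum_product_right]

theorem arcCount_le (l : ℕ) : arcCount n c F l ≤ n :=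
  (card_filter_le _ _).trans (card_range n).le

theorem arcCount_eq_zero {l : ℕ} (h : ∀ s, arc c s l ∉ F) : arcCount n c F l = 0 := by
  simp [arcCount, h]

theorem arcCount_filter_add (p : Finset α → Prop) [DecidablePred p] (l : ℕ) :
    arcCount n c {A ∈ F | p A} l + arcCount n c {A ∈ F | ¬ p A} l = arcCount n c F l := by
  simp only [arcCount, mem_filter]
  rw [← card_filter_add_card_filter_not (s := {s ∈ range n | arc c s l ∈ F})
    (fun s => p (arc c s l)), filter_filter, filter_filter]

theorem arc_subset_arc {s t l k : ℕ} (h1 : s ≤ t) (h2 : t + k ≤ s + l) :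
    arc c t k ⊆ arc c s l :=
  image_subset_image (Ico_subset_Ico h1 h2)

theorem arc_add_period (hc : IsCyclicNumbering n c) (s l : ℕ) : arc c (s + n) l = arc c s l := by
  rw [arc, arc, show s + n + l = s + l + n by ring, ← image_add_right_Ico, image_image]
  exact image_congr fun i _ => hc.periodic i

theorem arc_mod (hc : IsCyclicNumbering n c) (s l : ℕ) : arc c (s % n) l = arc c s l := by
  have h : ∀ q, arc c (s % n + q * n) l = arc c (s % n) l := by
    intro q
    induction q with
    | zero => simp
    | succ q ih => rw [add_mul, one_mul, ← add_assoc, arc_add_period hc, ih]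
  rw [← h (s / n), Nat.mod_add_div']

theorem card_arc (hc : IsCyclicNumbering n c) {s l : ℕ} (hl : l ≤ n) : #(arc c s l) = l := by
  rw [arc, card_image_of_injOn]
  · simp
  · intro i hi j hj hij
    simp only [coe_Ico, Set.mem_Ico] at hi hj
    rcases lt_trichotomy i j with h | h | h
    · exact absurd hij (hc.ne i j h (by omega))
    · exact h
    · exact absurd hij.symm (hc.ne j i h (by omega))

theorem arc_ssubset_arc (hc : IsCyclicNumbering n c) {s t l k : ℕ} (h1 : s ≤ t)
    (h2 : t + k ≤ s + l) (hkl : k < l) (hl : l ≤ n) : arc c t k ⊂ arc c s l := by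
  refine (arc_subset_arc h1 h2).ssubset_of_ne fun h => ?_
  have := congrArg card h
  rw [card_arc hc (by omega), card_arc hc hl] at this
  omega

theorem arc_inter_arc_eq_empty (hc : IsCyclicNumbering n c) {s l k : ℕ} (h : l + k ≤ n) :
    arc c s l ∩ arc c (s + l) k = ∅ := by
  rw [← disjoint_iff_inter_eq_empty, disjoint_left]
  intro x hx hy
  simp only [arc, mem_image, mem_Ico] at hx hy
  obtain ⟨i, hi, rfl⟩ := hx
  obtain ⟨j, hj, hij⟩ := hy
  exact hc.ne i j (by omega) (by omega) hij.symm

theorem sum_range_add_of_periodic {g : ℕ → ℕ} (hg : ∀ s, g (s + n) = g s) (l : ℕ) :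
    ∑ s ∈ range n, g (s + l) = ∑ s ∈ range n, g s := by
  induction l with
  | zero => simp
  | succ l ih =>
    rw [← ih]
    have h1 := sum_range_succ (fun s => g (s + l)) n
    have h2 := sum_range_succ' (fun s => g (s + l)) n
    have h3 : g (n + l) = g (0 + l) := by rw [add_comm n, hg, zero_add]
    have h4 : ∑ s ∈ range n, g (s + (l + 1)) = ∑ s ∈ range n, g (s + 1 + l) :=
      sum_congr rfl fun s _ => by congr 1; ring
    omega

theorem arcCount_add_le (hc : IsCyclicNumbering n c) (hF : Intersecting F) {l k : ℕ}
    (hlk : l + k ≤ n) : arcCount n c F l + arcCount n c F k ≤ n := by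
  have h1 : arcCount n c F k = ∑ s ∈ range n, if arc c (s + l) k ∈ F then 1 else 0 := by
    rw [sum_range_add_of_periodic (g := fun s => if arc c s k ∈ F then 1 else 0)
      (fun s => by rw [arc_add_period hc]), arcCount, card_filter]
  rw [h1, arcCount, card_filter, ← sum_add_distrib]
  calc _ ≤ ∑ s ∈ range n, 1 := by
        refine sum_le_sum fun s _ => ?_
        split_ifs with h2 h3 <;> try simp
        have := hF _ h2 _ h3
        rw [arc_inter_arc_eq_empty hc hlk] at this
        exact absurd this not_nonempty_empty
    _ = n := by simp

theorem arc_length_unique_of_antichain (hc : IsCyclicNumbering n c)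
    (hA : ∀ A ∈ F, ∀ B ∈ F, ¬ A ⊂ B) {s l k : ℕ} (hl : l ≤ n) (hk : k ≤ n)
    (h1 : arc c s l ∈ F) (h2 : arc c s k ∈ F) : l = k := by
  rcases lt_trichotomy l k with h | h | h
  · exact absurd (arc_ssubset_arc hc le_rfl (by omega) h hk) (hA _ h1 _ h2)
  · exact h
  · exact absurd (arc_ssubset_arc hc le_rfl (by omega) h hl) (hA _ h2 _ h1)

theorem injOn_fst_arcFamily (hc : IsCyclicNumbering n c) (hA : ∀ A ∈ F, ∀ B ∈ F, ¬ A ⊂ B) :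
    Set.InjOn Prod.fst (arcFamily n c F : Set (ℕ × ℕ)) := by
  rintro ⟨s, l⟩ hp ⟨t, k⟩ hq (rfl : s = t)
  simp only [mem_coe, mem_arcFamily] at hp hq
  rw [arc_length_unique_of_antichain hc hA hp.2.1 hq.2.1 hp.2.2 hq.2.2]

theorem image_fst_arcFamily_subset : (arcFamily n c F).image Prod.fst ⊆ range n := by
  intro s hs
  obtain ⟨p, hp, rfl⟩ := mem_image.1 hs
  exact mem_range.2 (mem_arcFamily.1 hp).1

theorem card_arcFamily_le_of_antichain (hc : IsCyclicNumbering n c)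
    (hA : ∀ A ∈ F, ∀ B ∈ F, ¬ A ⊂ B) : #(arcFamily n c F) ≤ n := by
  rw [← card_image_of_injOn (injOn_fst_arcFamily hc hA)]
  exact (card_le_card image_fst_arcFamily_subset).trans (card_range n).le

theorem exists_full_level_of_antichain (hn : 0 < n) (hc : IsCyclicNumbering n c)
    (hA : ∀ A ∈ F, ∀ B ∈ F, ¬ A ⊂ B) (hcard : n ≤ #(arcFamily n c F)) :
    ∃ l ≤ n, ∀ s, arc c s l ∈ F := by
  have himg : (arcFamily n c F).image Prod.fst = range n := by
    refine eq_of_subset_of_card_le image_fst_arcFamily_subset ?_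
    rwa [card_image_of_injOn (injOn_fst_arcFamily hc hA), card_range]
  have hex : ∀ s, ∃ l ≤ n, arc c s l ∈ F := by
    intro s
    have hs : s % n ∈ (arcFamily n c F).image Prod.fst := by
      rw [himg]; exact mem_range.2 (Nat.mod_lt _ hn)
    obtain ⟨p, hp, hps⟩ := mem_image.1 hs
    obtain ⟨-, h2, h3⟩ := mem_arcFamily.1 hp
    rw [hps, arc_mod hc] at h3
    exact ⟨p.2, h2, h3⟩
  choose L hLn hL using hex
  have hmono : Monotone L := by
    refine monotone_nat_of_le_succ fun s => ?_
    by_contra! h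
    exact hA _ (hL (s + 1)) _ (hL s) (arc_ssubset_arc hc (by omega) (by omega) h (hLn s))
  refine ⟨L 0, hLn 0, fun s => ?_⟩
  have h1 : L (s * n) = L 0 := by
    refine arc_length_unique_of_antichain hc hA (s := 0) (hLn _) (hLn _) ?_ (hL 0)
    have := hL (s * n)
    rwa [← arc_mod hc, Nat.mul_mod_left] at this
  have h2 : L s = L 0 :=
    le_antisymm (h1 ▸ hmono (Nat.le_mul_of_pos_right s hn)) (hmono (Nat.zero_le s))
  exact h2 ▸ hL s

section Height

variable {h : Finset α → ℕ} {I : Finset ℕ}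

theorem card_arcFamily_eq_sum (hI : ∀ A ∈ F, h A ∈ I) :
    #(arcFamily n c F) = ∑ i ∈ I, #(arcFamily n c {A ∈ F | h A = i}) := by
  rw [card_eq_sum_card_fiberwise (f := fun p => h (arc c p.1 p.2)) (t := I)
    fun p hp => hI _ (mem_arcFamily.1 hp).2.2]
  refine sum_congr rfl fun i _ => congrArg card ?_
  ext p
  simp only [mem_filter, mem_arcFamily, and_assoc]

theorem card_arcFamily_le (hc : IsCyclicNumbering n c)
    (hh : ∀ A ∈ F, ∀ B ∈ F, A ⊂ B → h A < h B) (hI : ∀ A ∈ F, h A ∈ I) :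
    #(arcFamily n c F) ≤ n * #I := by
  rw [card_arcFamily_eq_sum hI, mul_comm]
  exact sum_le_card_nsmul _ _ _ fun i _ =>
    card_arcFamily_le_of_antichain hc (not_ssubset_of_height_eq hh i)

theorem card_arcFamily_add_le_or_exists_full_level (hn : 0 < n) (hc : IsCyclicNumbering n c)
    (hh : ∀ A ∈ F, ∀ B ∈ F, A ⊂ B → h A < h B) (hI : ∀ A ∈ F, h A ∈ I) :
    #(arcFamily n c F) + #I ≤ n * #I ∨
      ∃ j ∈ I, ∃ l ≤ n, ∀ s, arc c s l ∈ F ∧ h (arc c s l) = j := by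
  by_cases hfull : ∃ j ∈ I, n ≤ #(arcFamily n c {A ∈ F | h A = j})
  · obtain ⟨j, hj, hcard⟩ := hfull
    obtain ⟨l, hl, hall⟩ :=
      exists_full_level_of_antichain hn hc (not_ssubset_of_height_eq hh j) hcard
    exact Or.inr ⟨j, hj, l, hl, fun s => mem_filter.1 (hall s)⟩
  · push Not at hfull
    left
    rw [card_arcFamily_eq_sum hI, card_eq_sum_ones I, ← sum_add_distrib, mul_sum]
    exact sum_le_sum fun i hi => by have := hfull i hi; omega

end Height

theorem sum_arcCount_mul_choose_le_of_odd {m k : ℕ} {h : Finset α → ℕ}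
    (hc : IsCyclicNumbering (2 * m + 1) c) (hF : Intersecting F)
    (hh : ∀ A ∈ F, ∀ B ∈ F, A ⊂ B → h A < h B) (hk : ∀ A ∈ F, h A < k) :
    ∑ l ∈ range (2 * m + 2), arcCount (2 * m + 1) c F l * (2 * m + 1).choose l ≤
      (2 * m + 1) * ∑ i ∈ range k, (2 * m + 1).choose (m + 1 + i) := by
  have hcard := card_arcFamily_le (I := range k) hc hh fun A hA => mem_range.2 (hk A hA)
  rw [card_arcFamily, card_range] at hcard
  have := sum_mul_choose_le_of_odd m k _ (arcCount (2 * m + 1) c F)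
    (fun l hl => arcCount_add_le hc hF (by omega)) hcard
  omega

theorem add_mul_choose_antitone (m : ℕ) :
    Antitone fun i => (m + i) * (2 * m).choose (m + i) := by
  refine antitone_nat_of_succ_le fun i => ?_
  have h1 := Nat.choose_succ_right_eq (2 * m) (m + i)
  calc (m + (i + 1)) * (2 * m).choose (m + (i + 1))
      = (2 * m).choose (m + i) * (2 * m - (m + i)) := by rw [← h1, ← add_assoc, mul_comm]
    _ ≤ (2 * m).choose (m + i) * (m + i) := by gcongr; omega
    _ = _ := mul_comm _ _

theorem sum_arcCount_mul_choose_le_of_even {m : ℕ} (hm : 0 < m) {h : Finset α → ℕ}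
    (hc : IsCyclicNumbering (2 * m) c) (k : ℕ) (F : Finset (Finset α)) (hF : Intersecting F)
    (hh : ∀ A ∈ F, ∀ B ∈ F, A ⊂ B → h A < h B) (hk : ∀ A ∈ F, h A < k) :
    ∑ l ∈ range (2 * m + 1), arcCount (2 * m) c F l * (2 * m).choose l
        + m * (2 * m).choose m + (m + k) * (2 * m).choose (m + k) ≤
      2 * m * ∑ i ∈ range (k + 1), (2 * m).choose (m + i) := by
  induction k using Nat.strong_induction_on generalizing F with
  | _ k ih =>
  have hsym : ∀ l ≤ 2 * m, arcCount (2 * m) c F l + arcCount (2 * m) c F (2 * m - l) ≤ 2 * m :=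
    fun l hl => arcCount_add_le hc hF (by omega)
  have of_card : (k ≤ m → #(arcFamily (2 * m) c F) + k ≤ 2 * m * k) →
      ∑ l ∈ range (2 * m + 1), arcCount (2 * m) c F l * (2 * m).choose l
        + m * (2 * m).choose m + (m + k) * (2 * m).choose (m + k) ≤
      2 * m * ∑ i ∈ range (k + 1), (2 * m).choose (m + i) := by
    intro hcard
    have h1 := sum_mul_choose_le_of_even m k _ _ hsym card_arcFamily.ge
    rw [sum_range_succ _ k]
    by_cases hkm : k ≤ m
    · have h2 := Nat.mul_le_mul_right ((2 * m).choose (m + k)) (hcard hkm)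
      linarith
    · rw [Nat.choose_eq_zero_of_lt (show 2 * m < m + k by omega)] at h1 ⊢
      linarith
  have hn : 0 < 2 * m := by omega
  obtain hcard | ⟨j, hj, l, hl, hfull⟩ := card_arcFamily_add_le_or_exists_full_level
    (I := range k) hn hc hh fun A hA => mem_range.2 (hk A hA)
  · rw [card_range] at hcard
    exact of_card fun _ => hcard
  rw [mem_range] at hj
  have hml : m < l := by
    by_contra! hlm
    have := hF _ (hfull 0).1 _ (hfull (0 + l)).1
    rw [arc_inter_arc_eq_empty hc (by omega)] at this
    exact not_nonempty_empty this
  obtain ⟨t, rfl⟩ := Nat.exists_eq_add_of_le hml.le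
  set F₁ : Finset (Finset α) := {A ∈ F | h A < j} with hF₁
  set F₂ : Finset (Finset α) := {A ∈ F | ¬ h A < j} with hF₂
  have hF₁sub : F₁ ⊆ F := filter_subset _ _
  have hF₂sub : F₂ ⊆ F := filter_subset _ _
  have hlow : ∀ r, m + t ≤ r → r ≤ 2 * m → ∀ s, arc c s r ∉ F₁ := by
    intro r h1 h2 s hs
    rw [hF₁, mem_filter] at hs
    obtain ⟨hf1, hf2⟩ := hfull s
    rcases h1.eq_or_lt with rfl | h1
    · omega
    · have := hh _ hf1 _ hs.1 (arc_ssubset_arc hc le_rfl (by omega) h1 h2)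
      omega
  have hupp : ∀ r < m + t, ∀ s, arc c s r ∉ F₂ := by
    intro r h1 s hs
    rw [hF₂, mem_filter] at hs
    obtain ⟨hf1, hf2⟩ := hfull s
    have := hh _ hs.1 _ hf1 (arc_ssubset_arc hc le_rfl (by omega) h1 hl)
    omega
  have hvlow : ∀ r, r + (m + t) ≤ 2 * m → ∀ s, arc c s r ∉ F₁ := by
    intro r h1 s hs
    have := hF _ (hF₁sub hs) _ (hfull (s + r)).1
    rw [arc_inter_arc_eq_empty hc h1] at this
    exact not_nonempty_empty this
  have hcard₂ : #(arcFamily (2 * m) c F₂) ≤ 2 * m * (k - j) := by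
    have := card_arcFamily_le (I := Ico j k) hc
      (fun A hA B hB => hh A (hF₂sub hA) B (hF₂sub hB)) fun A hA => ?_
    · rwa [Nat.card_Ico] at this
    · rw [hF₂, mem_filter] at hA
      exact mem_Ico.2 ⟨not_lt.1 hA.2, hk A hA.1⟩
  by_cases htj : t ≤ j
  · refine of_card fun hkm => ?_
    have h1 := sum_range_add_middle (arcCount (2 * m) c F₁) m
    obtain ⟨r, rfl⟩ : ∃ r, t = r + 1 := ⟨t - 1, by omega⟩
    have h2 : ∑ i ∈ range (m + 1), (arcCount (2 * m) c F₁ (m + i) + arcCount (2 * m) c F₁ (m - i))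
        = ∑ i ∈ range (r + 1),
          (arcCount (2 * m) c F₁ (m + i) + arcCount (2 * m) c F₁ (m - i)) := by
      refine (sum_subset (range_subset_range.2 (by omega)) fun i hi hi' => ?_).symm
      rw [mem_range] at hi hi'
      rw [arcCount_eq_zero (hlow _ (by omega) (by omega)), arcCount_eq_zero (hvlow _ (by omega)),
        add_zero]
    rw [h2, sum_range_succ' _ r, add_zero, tsub_zero] at h1
    have hF₁i : Intersecting F₁ := fun A hA B hB => hF A (hF₁sub hA) B (hF₁sub hB)
    have h3 : ∑ i ∈ range r,
        (arcCount (2 * m) c F₁ (m + (i + 1)) + arcCount (2 * m) c F₁ (m - (i + 1))) ≤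
          2 * m * r := by
      have := sum_le_card_nsmul (range r) _ (2 * m) fun i hi =>
        arcCount_add_le hc hF₁i (l := m + (i + 1)) (k := m - (i + 1))
          (by have := mem_range.1 hi; omega)
      rwa [card_range, smul_eq_mul, mul_comm r] at this
    have h4 := arcCount_add_le hc hF₁i (l := m) (k := m) (by omega)
    have h5 : #(arcFamily (2 * m) c F) =
        #(arcFamily (2 * m) c F₁) + #(arcFamily (2 * m) c F₂) := by
      simp only [card_arcFamily, ← sum_add_distrib]
      exact sum_congr rfl fun l _ => (arcCount_filter_add _ l).symm
    have h6 : 2 * m * r + 2 * m * (k - j) + 2 * m ≤ 2 * m * k := by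
      rw [← mul_add, ← mul_add_one]
      exact Nat.mul_le_mul_left _ (by omega)
    have h7 := card_arcFamily (n := 2 * m) (c := c) (F := F₁)
    omega
  · push Not at htj
    have hF₁i : Intersecting F₁ := fun A hA B hB => hF A (hF₁sub hA) B (hF₁sub hB)
    have h1 := ih j hj F₁ hF₁i (fun A hA B hB => hh A (hF₁sub hA) B (hF₁sub hB))
      fun A hA => (mem_filter.1 hA).2
    have h2 : ∑ l ∈ range (2 * m + 1), arcCount (2 * m) c F₂ l * (2 * m).choose l ≤
        2 * m * ∑ i ∈ range (k - j), (2 * m).choose (m + (j + 1 + i)) := by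
      have h6 : ∑ i ∈ range (m - j), arcCount (2 * m) c F₂ (m + (j + 1 + i)) ≤
          2 * m * (k - j) := by
        refine le_trans ?_ hcard₂
        rw [card_arcFamily, show 2 * m + 1 = m + (j + 1) + (m - j) by omega, sum_range_add]
        simp only [← add_assoc, le_add_iff_nonneg_left, Nat.zero_le]
      have h7 := sum_mul_add_le_of_antitone
        (w := fun i => (2 * m).choose (m + (j + 1 + i))) (m - j) (k - j) (2 * m) _
        (fun a b hab => choose_add_antitone (n := 2 * m) (r := m) (by omega)
          (Nat.add_le_add_left hab (j + 1))) (fun i _ => arcCount_le _) h6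
      have h8 : ∑ l ∈ range (2 * m + 1), arcCount (2 * m) c F₂ l * (2 * m).choose l =
          ∑ i ∈ range (m - j), arcCount (2 * m) c F₂ (m + (j + 1 + i)) *
            (2 * m).choose (m + (j + 1 + i)) := by
        conv_lhs => rw [show 2 * m + 1 = m + (j + 1) + (m - j) by omega, sum_range_add]
        rw [sum_eq_zero, zero_add]
        · simp only [← add_assoc]
        · intro l hl
          rw [arcCount_eq_zero (hupp l (by have := mem_range.1 hl; omega)), zero_mul]
      rw [h8]
      omega
    have h3 : ∑ i ∈ range (k + 1), (2 * m).choose (m + i) =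
        ∑ i ∈ range (j + 1), (2 * m).choose (m + i) +
        ∑ i ∈ range (k - j), (2 * m).choose (m + (j + 1 + i)) := by
      rw [← sum_range_add (fun i => (2 * m).choose (m + i))]
      congr 2; omega
    have h4 : ∑ l ∈ range (2 * m + 1), arcCount (2 * m) c F l * (2 * m).choose l =
        ∑ l ∈ range (2 * m + 1), arcCount (2 * m) c F₁ l * (2 * m).choose l +
        ∑ l ∈ range (2 * m + 1), arcCount (2 * m) c F₂ l * (2 * m).choose l := by
      rw [← sum_add_distrib]
      exact sum_congr rfl fun l _ => by rw [← add_mul, arcCount_filter_add]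
    have h5 := add_mul_choose_antitone m hj.le
    simp only at h5
    rw [h3, h4, mul_add]
    omega

end Arc

theorem exists_perm_image_eq {α : Type*} [Fintype α] [DecidableEq α] {A B : Finset α}
    (h : #A = #B) : ∃ τ : Equiv.Perm α, A.image τ = B := by
  refine ⟨(equivOfCardEq h).extendSubtype, eq_of_subset_of_card_le (fun x hx => ?_) ?_⟩
  · obtain ⟨a, ha, rfl⟩ := mem_image.1 hx
    exact (equivOfCardEq h).extendSubtype_mem a ha
  · rw [card_image_of_injective _ (Equiv.injective _), h]

theorem card_perm_image_mem_mul_choose {α : Type*} [Fintype α] [DecidableEq α]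
    (F : Finset (Finset α)) (B : Finset α) :
    #{σ : Equiv.Perm α | B.image σ ∈ F} * (Fintype.card α).choose #B =
      (Fintype.card α).factorial * #{A ∈ F | #A = #B} := by
  have hconst : ∀ B' ∈ powersetCard #B univ,
      #{σ : Equiv.Perm α | B'.image σ ∈ F} = #{σ : Equiv.Perm α | B.image σ ∈ F} := by
    intro B' hB'
    obtain ⟨τ, rfl⟩ := exists_perm_image_eq (mem_powersetCard.1 hB').2.symm
    refine card_equiv (Equiv.mulRight τ) fun σ => ?_
    simp [image_image]
  calc _ = ∑ B' ∈ powersetCard #B univ, #{σ : Equiv.Perm α | B'.image σ ∈ F} := by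
        rw [sum_congr rfl hconst, sum_const, card_powersetCard, card_univ, smul_eq_mul, mul_comm]
    _ = ∑ σ : Equiv.Perm α, #{B' ∈ powersetCard #B univ | B'.image σ ∈ F} := by
        simp only [card_filter]
        exact sum_comm
    _ = ∑ σ : Equiv.Perm α, #{A ∈ F | #A = #B} := by
        refine sum_congr rfl fun σ _ => card_equiv (Equiv.finsetCongr σ) fun B' => ?_
        simp [Equiv.finsetCongr, map_eq_image, and_comm, card_image_of_injective _ σ.injective]
    _ = _ := by rw [sum_const, card_univ, Fintype.card_perm, smul_eq_mul]

/-- The cyclic order in which a permutation of `Fin n` lists its elements. -/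
def cyclicOrder {n : ℕ} [NeZero n] (σ : Equiv.Perm (Fin n)) (i : ℕ) : Fin n :=
  σ (Fin.ofNat n i)

theorem isCyclicNumbering_cyclicOrder {n : ℕ} [NeZero n] (σ : Equiv.Perm (Fin n)) :
    IsCyclicNumbering n (cyclicOrder σ) where
  periodic i := by simp [cyclicOrder, Fin.ofNat]
  ne i j h1 h2 h := by
    have h3 : i % n = j % n := by simpa [cyclicOrder, Fin.ofNat] using h
    have h4 : n ∣ j - i := (Nat.modEq_iff_dvd' h1.le).1 h3
    have := Nat.le_of_dvd (by omega) h4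
    omega

theorem sum_perm_arcCount_mul_choose {n : ℕ} [NeZero n] (F : Finset (Finset (Fin n))) :
    ∑ σ : Equiv.Perm (Fin n), ∑ l ∈ range (n + 1), arcCount n (cyclicOrder σ) F l * n.choose l =
      n.factorial * (n * #F) := by
  have hl : ∀ l ∈ range (n + 1), ∑ σ : Equiv.Perm (Fin n),
      arcCount n (cyclicOrder σ) F l * n.choose l = n.factorial * n * #{A ∈ F | #A = l} := by
    intro l hl
    have hs : ∀ s ∈ range n, #{σ : Equiv.Perm (Fin n) | arc (cyclicOrder σ) s l ∈ F} * n.choose l =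
        n.factorial * #{A ∈ F | #A = l} := by
      intro s _
      have hcard : #(arc (cyclicOrder (1 : Equiv.Perm (Fin n))) s l) = l :=
        card_arc (isCyclicNumbering_cyclicOrder _) (Nat.lt_succ_iff.1 (mem_range.1 hl))
      have himg : ∀ σ : Equiv.Perm (Fin n),
          (arc (cyclicOrder (1 : Equiv.Perm (Fin n))) s l).image σ = arc (cyclicOrder σ) s l :=
        fun σ => image_image
      have := card_perm_image_mem_mul_choose F (arc (cyclicOrder (1 : Equiv.Perm (Fin n))) s l)
      rw [hcard, Fintype.card_fin] at this
      rw [← this]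
      congr 2
      exact filter_congr fun σ _ => by rw [himg]
    rw [← sum_mul]
    simp only [arcCount, card_filter]
    rw [sum_comm]
    simp only [← card_filter]
    rw [sum_mul, sum_congr rfl hs, sum_const, card_range, smul_eq_mul]
    ring
  rw [sum_comm, sum_congr rfl hl, ← mul_sum, mul_assoc]
  rw [card_eq_sum_card_fiberwise (f := card) (t := range (n + 1)) (s := F)]
  intro A _
  have := card_le_univ A
  rw [Fintype.card_fin] at this
  exact mem_coe.2 (mem_range.2 (by omega))

theorem mul_card_le_of_forall_cyclicOrder {n a T : ℕ} [NeZero n] {F : Finset (Finset (Fin n))}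
    (h : ∀ σ : Equiv.Perm (Fin n),
      ∑ l ∈ range (n + 1), arcCount n (cyclicOrder σ) F l * n.choose l + a ≤ T) :
    n * #F + a ≤ T := by
  have h1 := sum_le_sum fun σ (_ : σ ∈ univ) => h σ
  rw [sum_add_distrib, sum_perm_arcCount_mul_choose, sum_const, sum_const, card_univ,
    Fintype.card_perm, Fintype.card_fin, smul_eq_mul, smul_eq_mul, ← mul_add] at h1
  exact Nat.le_of_mul_le_mul_left h1 n.factorial_pos

theorem sigmaI_two_mul_add_one (m k : ℕ) :
    SigmaI (2 * m + 1) k = ∑ i ∈ range k, (2 * m + 1).choose (m + 1 + i) := by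
  rw [SigmaI, if_pos (by omega), show (2 * m + 1 + 1) / 2 = m + 1 by omega,
    show Icc (m + 1) (m + 1 + k - 1) = Ico (m + 1) (m + 1 + k) by ext; simp; omega,
    sum_Ico_eq_sum_range]
  simp

theorem two_mul_mul_sigmaI_two_mul {m k : ℕ} (hm : 0 < m) (hk : 1 ≤ k) :
    2 * m * SigmaI (2 * m) k + (m * (2 * m).choose m + (m + k) * (2 * m).choose (m + k)) =
      2 * m * ∑ i ∈ range (k + 1), (2 * m).choose (m + i) := by
  obtain ⟨k, rfl⟩ := Nat.exists_eq_add_of_le' hk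
  rw [SigmaI, if_neg (by omega), show 2 * m / 2 = m by omega,
    show Icc (m + 1) (m + (k + 1) - 1) = Ico (m + 1) (m + 1 + k) by ext; simp; omega,
    sum_Ico_eq_sum_range, sum_range_succ, sum_range_succ']
  obtain ⟨m, rfl⟩ := Nat.exists_eq_add_of_le' hm
  have h1 := Nat.add_one_mul_choose_eq (2 * m + 1) m
  have h2 := Nat.add_one_mul_choose_eq (2 * m + 1) (m + 1 + k)
  have h3 := Nat.choose_succ_succ (2 * m + 1) (m + 1 + k)
  simp only [show 2 * (m + 1) = 2 * m + 1 + 1 by ring, Nat.add_sub_cancel, Nat.succ_eq_add_one,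
    show m + 1 + k + 1 - (m + 1 + 1) = k by omega, add_zero, zero_add,
    show m + 1 + (k + 1) = m + 1 + k + 1 by ring,
    show m + 1 + 1 + k = m + 1 + k + 1 by ring,
    show ∀ i, m + 1 + 1 + i = m + 1 + (i + 1) by intro i; ring] at *
  rw [h3] at h2 ⊢
  linarith

end IntersectingSperner

theorem intersecting_kSperner_card_le (n k : ℕ) (hk : 1 ≤ k)
    (F : Finset (Finset (Fin n))) (hF : Intersecting F) (hS : KSperner k F) :
    F.card ≤ SigmaI n k := by
  obtain ⟨h, hlt, hmono⟩ := exists_strictMonoOn_of_kSperner hS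
  rcases Nat.even_or_odd' n with ⟨m, rfl | rfl⟩
  · rcases Nat.eq_zero_or_pos m with rfl | hm
    · have hempty : F = ∅ := by
        refine Finset.eq_empty_of_forall_notMem fun A hA => ?_
        obtain ⟨x, -⟩ := hF A hA A hA
        exact x.elim0
      simp [hempty]
    · have : NeZero (2 * m) := ⟨by omega⟩
      have := mul_card_le_of_forall_cyclicOrder fun σ =>
        (add_assoc _ _ _).symm.trans_le <| sum_arcCount_mul_choose_le_of_even hm
          (isCyclicNumbering_cyclicOrder σ) k F hF hmono hlt
      rw [← two_mul_mul_sigmaI_two_mul hm hk] at this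
      exact Nat.le_of_mul_le_mul_left (Nat.le_of_add_le_add_right this) (by omega)
  · have := mul_card_le_of_forall_cyclicOrder (a := 0) fun σ =>
      sum_arcCount_mul_choose_le_of_odd (isCyclicNumbering_cyclicOrder σ) hF hmono hlt
    rw [sigmaI_two_mul_add_one]
    exact Nat.le_of_mul_le_mul_left this (by omega)
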